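/- Let Ĝ be the (unique) maximum likelihood estimator, and let Y₁ < Y₂ < … < Y_m be the points of its support, with m < n. Then there exists a subsequence of indices i₁ < i₂ < … < i_m in {1, …, n} such that X_{i_j} < Y_j < X_{i_{j+k}} for every j = 1, …, m, where X_{i_l} is interpreted as +∞ whenever l > m. -/

import Mathlib

open Set MeasureTheory

/-- The `k`-monotone mixture density `f_G(x) = ∫ k (y - x)₊^{k-1} / y^k dG(y)`. -/
noncomputable def mixDens (k : ℕ) (G : Measure ℝ) (x : ℝ) : ℝ :=
  ∫ y, (k : ℝ) * max (y - x) 0 ^ (k - 1) / y ^ k ∂G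

/-- The likelihood of the mixing measure `G` given observations `X₁, …, X_n`. -/
noncomputable def lik (k n : ℕ) (X : Fin n → ℝ) (G : Measure ℝ) : ℝ :=
  ∏ i, mixDens k G (X i)

/-- `G` is a maximum likelihood estimator: a probability measure on `(0, ∞)` whose
likelihood is at least that of any other probability measure on `(0, ∞)`. -/
def IsMLE (k n : ℕ) (X : Fin n → ℝ) (G : Measure ℝ) : Prop :=
  IsProbabilityMeasure G ∧ G (Iic 0) = 0 ∧
    ∀ G' : Measure ℝ, IsProbabilityMeasure G' → G' (Iic 0) = 0 →
      lik k n X G' ≤ lik k n X G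


/-- The spline `A y^{e+2} - ∑ c_i (y - X_i)₊^{e+1}` with knots `X_i`. -/
noncomputable def truncSpline {ι : Type*} [Fintype ι] (e : ℕ) (A : ℝ) (c X : ι → ℝ) (y : ℝ) : ℝ :=
  A * y ^ (e + 2) - ∑ i, c i * max (y - X i) 0 ^ (e + 1)

theorem hasDerivAt_max_sub_zero_pow (e : ℕ) (a y : ℝ) :
    HasDerivAt (fun y : ℝ => max (y - a) 0 ^ (e + 2))
      ((e + 2 : ℝ) * max (y - a) 0 ^ (e + 1)) y := by
  have key : ∀ z ≠ a, HasDerivAt (fun y : ℝ => max (y - a) 0 ^ (e + 2))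
      ((e + 2 : ℝ) * max (z - a) 0 ^ (e + 1)) z := by
    intro z hz
    rcases lt_or_gt_of_ne hz with h | h
    · have : (fun y : ℝ => max (y - a) 0 ^ (e + 2)) =ᶠ[nhds z] fun _ => 0 := by
        filter_upwards [Iio_mem_nhds h] with w hw
        rw [max_eq_right (by linarith [mem_Iio.1 hw])]
        simp
      rw [max_eq_right (by linarith)]
      simpa using (hasDerivAt_const z (0 : ℝ)).congr_of_eventuallyEq this
    · have : (fun y : ℝ => max (y - a) 0 ^ (e + 2)) =ᶠ[nhds z] fun y => (y - a) ^ (e + 2) := by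
        filter_upwards [Ioi_mem_nhds h] with w hw
        rw [max_eq_left (by linarith [mem_Ioi.1 hw])]
      rw [max_eq_left (by linarith)]
      have h2 := ((hasDerivAt_id' z).sub_const a).fun_pow (e + 2)
      refine HasDerivAt.congr_of_eventuallyEq ?_ this
      simpa using h2
  rcases eq_or_ne y a with rfl | h
  · exact hasDerivAt_of_hasDerivAt_of_ne key (by fun_prop)
      (g := fun z => (e + 2 : ℝ) * max (z - y) 0 ^ (e + 1)) (by fun_prop)
  · exact key y h

section Spline

variable {ι : Type*} [Fintype ι]

theorem continuous_truncSpline (e : ℕ) (A : ℝ) (c X : ι → ℝ) :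
    Continuous (truncSpline e A c X) := by
  unfold truncSpline
  fun_prop

theorem hasDerivAt_truncSpline (e : ℕ) (A : ℝ) (c X : ι → ℝ) (y : ℝ) :
    HasDerivAt (truncSpline (e + 1) A c X)
      (truncSpline e ((e + 3) * A) (fun i => (e + 2) * c i) X y) y := by
  unfold truncSpline
  have h1 := (hasDerivAt_pow (e + 3) y).const_mul A
  have h2 : HasDerivAt (fun y => ∑ i, c i * max (y - X i) 0 ^ (e + 2))
      (∑ i, c i * ((e + 2 : ℝ) * max (y - X i) 0 ^ (e + 1))) y :=
    HasDerivAt.fun_sum fun i _ => (hasDerivAt_max_sub_zero_pow e (X i) y).const_mul (c i)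
  have h3 : ∑ i, (e + 2) * c i * max (y - X i) 0 ^ (e + 1) =
      ∑ i, c i * ((e + 2 : ℝ) * max (y - X i) 0 ^ (e + 1)) :=
    Finset.sum_congr rfl fun i _ => by ring
  refine (h1.fun_sub h2).congr_deriv ?_
  rw [h3, Nat.add_sub_cancel (n := e + 2) (m := 1)]
  push_cast
  ring

theorem truncSpline_zero (e : ℕ) (A : ℝ) (c : ι → ℝ) {X : ι → ℝ} (hX : ∀ i, 0 < X i) :
    truncSpline e A c X 0 = 0 := by
  unfold truncSpline
  have : ∀ i, max (-X i) 0 = 0 := fun i => max_eq_right (by linarith [hX i])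
  simp [this]

/-- Rolle's theorem for truncated splines. -/
theorem exists_zero_truncSpline_between {e : ℕ} {A : ℝ} {c X : ι → ℝ} {x y : ℝ} (hxy : x < y)
    (hx : truncSpline (e + 1) A c X x = 0) (hy : truncSpline (e + 1) A c X y = 0) :
    ∃ z, x < z ∧ z < y ∧
      truncSpline e ((e + 3) * A) (fun i => (e + 2) * c i) X z = 0 := by
  obtain ⟨z, hz, h⟩ := exists_hasDerivAt_eq_zero hxy
    (continuous_truncSpline (e + 1) A c X).continuousOn (hx.trans hy.symm)
    (fun z _ => hasDerivAt_truncSpline e A c X z)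
  exact ⟨z, hz.1, hz.2, h⟩

/-- The number of knots strictly between `a` and `b`. -/
noncomputable def knotCount (X : ι → ℝ) (a b : ℝ) : ℕ :=
  (Finset.univ.filter fun i => a < X i ∧ X i < b).card

theorem knotCount_mono (X : ι → ℝ) (a : ℝ) {b b' : ℝ} (h : b ≤ b') :
    knotCount X a b ≤ knotCount X a b' :=
  Finset.card_le_card fun i hi => by
    simp only [Finset.mem_filter, Finset.mem_univ, true_and] at hi ⊢
    exact ⟨hi.1, hi.2.trans_le h⟩

open Classical in
/-- On the right of `a`, the piecewise quadratic spline is a fixed quadratic polynomial between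
consecutive knots. -/
theorem exists_quadratic_of_knotCount (A : ℝ) (c X : ι → ℝ) (a : ℝ) (N : ℕ) :
    ∃ β γ : ℝ, ∀ y, a ≤ y → knotCount X a y = N →
      truncSpline 0 A c X y = A * y ^ 2 - β * y + γ := by
  by_cases hex : ∃ y₀, a ≤ y₀ ∧ knotCount X a y₀ = N
  swap
  · exact ⟨0, 0, fun y h1 h2 => absurd ⟨y, h1, h2⟩ hex⟩
  obtain ⟨y₀, ha₀, hN₀⟩ := hex
  set F : ℝ → Finset ι := fun y => Finset.univ.filter fun i => a < X i ∧ X i < y with hF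
  have hmono : ∀ {y y'}, y ≤ y' → F y ⊆ F y' := fun h i hi => by
    simp only [hF, Finset.mem_filter, Finset.mem_univ, true_and] at hi ⊢
    exact ⟨hi.1, hi.2.trans_le h⟩
  refine ⟨∑ i, if X i ≤ a ∨ i ∈ F y₀ then c i else 0,
    ∑ i, if X i ≤ a ∨ i ∈ F y₀ then c i * X i else 0, fun y ha hN => ?_⟩
  have hcard : (F y).card = (F y₀).card := hN.trans hN₀.symm
  have hFy : F y = F y₀ := by
    rcases le_total y y₀ with h | h
    · exact Finset.eq_of_subset_of_card_le (hmono h) hcard.ge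
    · exact (Finset.eq_of_subset_of_card_le (hmono h) hcard.le).symm
  rw [← hFy]
  unfold truncSpline
  rw [sub_add, Finset.sum_mul, ← Finset.sum_sub_distrib]
  congr 1
  refine Finset.sum_congr rfl fun i _ => ?_
  simp only [zero_add, pow_one]
  split_ifs with h
  · rw [max_eq_left]
    · ring
    · rcases h with h | h
      · linarith
      · simp only [hF, Finset.mem_filter, Finset.mem_univ, true_and] at h
        linarith
  · push Not at h
    rw [max_eq_right]
    · ring
    · by_contra hlt
      push Not at hlt
      exact h.2 (Finset.mem_filter.2 ⟨Finset.mem_univ i, h.1, by linarith⟩)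

theorem card_le_of_fiber_card_le {X : ι → ℝ} {a b : ℝ} {s : Finset ℝ} (hs : ∀ y ∈ s, y ≤ b)
    (r : ℕ) (hr : ∀ N, (s.filter fun y => knotCount X a y = N).card ≤ r) :
    s.card ≤ r * (knotCount X a b + 1) := by
  have h := Finset.card_le_mul_card_image (f := fun y => knotCount X a y) s r (fun N _ => hr N)
  refine h.trans (Nat.mul_le_mul_left r ?_)
  calc _ ≤ (Finset.range (knotCount X a b + 1)).card := by
        refine Finset.card_le_card fun N hN => ?_
        obtain ⟨y, hy, rfl⟩ := Finset.mem_image.1 hN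
        exact Finset.mem_range.2 (Nat.lt_succ_of_le (knotCount_mono X a (hs y hy)))
    _ = _ := Finset.card_range _

theorem card_zeros_truncSpline_zero_le {A : ℝ} (hA : A ≠ 0) {c X : ι → ℝ} {a b : ℝ}
    {s : Finset ℝ} (hs : ∀ y ∈ s, y ∈ Icc a b ∧ truncSpline 0 A c X y = 0) :
    s.card ≤ 2 * (knotCount X a b + 1) := by
  refine card_le_of_fiber_card_le (fun y hy => (hs y hy).1.2) 2 fun N => ?_
  obtain ⟨β, γ, hq⟩ := exists_quadratic_of_knotCount A c X a N
  by_contra! hlt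
  obtain ⟨x, hx, y, hy, z, hz, hxy, hxz, hyz⟩ := Finset.two_lt_card.1 hlt
  have key : ∀ w ∈ s.filter (fun y => knotCount X a y = N), A * w ^ 2 - β * w + γ = 0 := by
    intro w hw
    obtain ⟨hws, hwN⟩ := Finset.mem_filter.1 hw
    rw [← hq w (hs w hws).1.1 hwN, (hs w hws).2]
  have e1 : A * (x + y) = β := mul_right_cancel₀ (sub_ne_zero.2 hxy)
    (by linear_combination key x hx - key y hy)
  have e2 : A * (x + z) = β := mul_right_cancel₀ (sub_ne_zero.2 hxz)
    (by linear_combination key x hx - key z hz)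
  have := mul_left_cancel₀ hA (e1.trans e2.symm)
  exact hyz (by linarith)

theorem card_zeros_truncSpline_zero_le_of_nonneg {A : ℝ} (hA : 0 < A) {c X : ι → ℝ} {a b : ℝ}
    (hnn : ∀ y, a ≤ y → 0 ≤ truncSpline 0 A c X y)
    {s : Finset ℝ} (hs : ∀ y ∈ s, y ∈ Icc a b ∧ truncSpline 0 A c X y = 0) :
    s.card ≤ knotCount X a b + 1 := by
  rw [← one_mul (_ + 1)]
  refine card_le_of_fiber_card_le (fun y hy => (hs y hy).1.2) 1 fun N => ?_
  obtain ⟨β, γ, hq⟩ := exists_quadratic_of_knotCount A c X a N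
  have aux : ∀ x ∈ s.filter (fun y => knotCount X a y = N),
      ∀ y ∈ s.filter (fun y => knotCount X a y = N), ¬ x < y := by
    intro x hx y hy hlt
    obtain ⟨hxs, hxN⟩ := Finset.mem_filter.1 hx
    obtain ⟨hys, hyN⟩ := Finset.mem_filter.1 hy
    have hax := (hs x hxs).1.1
    have h1 := hq x hax hxN
    have h2 := hq y (hs y hys).1.1 hyN
    have hm : knotCount X a ((x + y) / 2) = N := le_antisymm
      (hyN ▸ knotCount_mono X a (by linarith)) (hxN ▸ knotCount_mono X a (by linarith))
    have h3 := hq ((x + y) / 2) (by linarith) hm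
    have h4 := hnn ((x + y) / 2) (by linarith)
    rw [(hs x hxs).2] at h1
    rw [(hs y hys).2] at h2
    have h5 : 0 < A * (y - x) ^ 2 := by
      have := sub_pos.2 hlt
      positivity
    nlinarith
  exact Finset.card_le_one.2 fun x hx y hy =>
    le_antisymm (not_lt.1 (aux y hy x hx)) (not_lt.1 (aux x hx y hy))

theorem exists_finset_of_card_bound {Z : Set ℝ} {B : ℕ}
    (h : ∀ s : Finset ℝ, (∀ y ∈ s, y ∈ Z) → s.card ≤ B) :
    ∃ t : Finset ℝ, (∀ y, y ∈ t ↔ y ∈ Z) ∧ t.card ≤ B := by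
  have hfin : Z.Finite := by
    by_contra hinf
    obtain ⟨s, hs, hc⟩ := Set.Infinite.exists_subset_card_eq hinf (B + 1)
    have := h s fun y hy => hs hy
    omega
  exact ⟨hfin.toFinset, fun y => hfin.mem_toFinset, h _ fun y hy => hfin.mem_toFinset.1 hy⟩

theorem exists_finset_zeros_truncSpline (e : ℕ) {A : ℝ} (hA : A ≠ 0) (c X : ι → ℝ) (a b : ℝ) :
    ∃ t : Finset ℝ, (∀ y, y ∈ t ↔ y ∈ Icc a b ∧ truncSpline e A c X y = 0) ∧
      t.card ≤ 2 * (knotCount X a b + 1) + e := by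
  induction e generalizing A c with
  | zero => exact exists_finset_of_card_bound fun s hs => card_zeros_truncSpline_zero_le hA hs
  | succ e ih =>
    obtain ⟨t, ht, hcard⟩ := ih (A := (e + 3) * A) (mul_ne_zero (by positivity) hA)
      (fun i => (e + 2) * c i)
    refine exists_finset_of_card_bound fun s hs => ?_
    have := Finset.card_le_of_interleaved (s := s) (t := t) fun x hx y hy hxy _ => by
      obtain ⟨z, hxz, hzy, hz⟩ := exists_zero_truncSpline_between hxy (hs x hx).2 (hs y hy).2
      exact ⟨z, (ht z).2 ⟨⟨(hs x hx).1.1.trans hxz.le, hzy.le.trans (hs y hy).1.2⟩, hz⟩,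
        hxz, hzy⟩
    omega

theorem exists_finset_zeros_truncSpline_Icc_zero (e : ℕ) {A : ℝ} (hA : A ≠ 0) (c : ι → ℝ)
    {X : ι → ℝ} (hX : ∀ i, 0 < X i) {b : ℝ} (hb : 0 ≤ b) :
    ∃ t : Finset ℝ, (∀ y, y ∈ t ↔ y ∈ Icc 0 b ∧ truncSpline e A c X y = 0) ∧
      t.card ≤ 2 * (knotCount X 0 b + 1) := by
  induction e generalizing A c with
  | zero => exact exists_finset_of_card_bound fun s hs => card_zeros_truncSpline_zero_le hA hs
  | succ e ih =>
    obtain ⟨t, ht, hcard⟩ := ih (A := (e + 3) * A) (mul_ne_zero (by positivity) hA)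
      (fun i => (e + 2) * c i)
    refine exists_finset_of_card_bound fun s hs => ?_
    have hs' : ∀ y ∈ insert 0 s, y ∈ Icc 0 b ∧ truncSpline (e + 1) A c X y = 0 := by
      intro y hy
      rcases Finset.mem_insert.1 hy with rfl | hy
      · exact ⟨⟨le_rfl, hb⟩, truncSpline_zero _ _ _ hX⟩
      · exact hs y hy
    have h1 := Finset.card_le_sdiff_of_interleaved (s := insert 0 s) (t := t)
      fun x hx y hy hxy _ => by
        obtain ⟨z, hxz, hzy, hz⟩ := exists_zero_truncSpline_between hxy (hs' x hx).2 (hs' y hy).2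
        exact ⟨z, (ht z).2 ⟨⟨(hs' x hx).1.1.trans hxz.le, hzy.le.trans (hs' y hy).1.2⟩, hz⟩,
          hxz, hzy⟩
    have h0t : (0 : ℝ) ∈ t := (ht 0).2 ⟨⟨le_rfl, hb⟩, truncSpline_zero _ _ _ hX⟩
    have h2 : (t \ insert 0 s).card < t.card := Finset.card_lt_card
      ⟨Finset.sdiff_subset, fun h => (Finset.mem_sdiff.1 (h h0t)).2 (Finset.mem_insert_self _ _)⟩
    have h3 := Finset.card_le_card (Finset.subset_insert 0 s)
    omega

/-- Between zeros of a truncated spline which are also zeros of its derivative, Rolle's theorem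
doubles the number of zeros of the derivative. -/
theorem two_mul_card_le_of_double_zeros {e : ℕ} {A : ℝ} {c X : ι → ℝ} {a b : ℝ} {s t : Finset ℝ}
    (hs : ∀ y ∈ s, y ∈ Icc a b ∧ truncSpline (e + 1) A c X y = 0 ∧
      truncSpline e ((e + 3) * A) (fun i => (e + 2) * c i) X y = 0)
    (ht : ∀ y, y ∈ t ↔ y ∈ Icc a b ∧
      truncSpline e ((e + 3) * A) (fun i => (e + 2) * c i) X y = 0) :
    2 * s.card ≤ t.card + 1 := by
  have h1 := Finset.card_le_sdiff_of_interleaved (s := s) (t := t) fun x hx y hy hxy _ => by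
    obtain ⟨z, hxz, hzy, hz⟩ := exists_zero_truncSpline_between hxy (hs x hx).2.1 (hs y hy).2.1
    exact ⟨z, (ht z).2 ⟨⟨(hs x hx).1.1.trans hxz.le, hzy.le.trans (hs y hy).1.2⟩, hz⟩, hxz, hzy⟩
  have hst : s ⊆ t := fun y hy => (ht y).2 ⟨(hs y hy).1, (hs y hy).2.2⟩
  have h2 := Finset.card_sdiff_add_card_eq_card hst
  omega

theorem truncSpline_derivative_eq_zero {e : ℕ} {A : ℝ} {c X : ι → ℝ}
    (hnn : ∀ y, 0 ≤ y → 0 ≤ truncSpline (e + 1) A c X y) {y : ℝ} (hy : 0 < y)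
    (h : truncSpline (e + 1) A c X y = 0) :
    truncSpline e ((e + 3) * A) (fun i => (e + 2) * c i) X y = 0 := by
  refine IsLocalMin.hasDerivAt_eq_zero (f := truncSpline (e + 1) A c X) ?_
    (hasDerivAt_truncSpline e A c X y)
  filter_upwards [Ioi_mem_nhds hy] with z hz
  rw [h]
  exact hnn z (le_of_lt hz)

/-- A nonnegative truncated spline with `p` positive zeros up to `b` has at least `p` knots
below `b`. -/
theorem card_zeros_le_knotCount_zero {e : ℕ} {A : ℝ} (hA : 0 < A) {c X : ι → ℝ}
    (hX : ∀ i, 0 < X i) (hnn : ∀ y, 0 ≤ y → 0 ≤ truncSpline e A c X y) {b : ℝ} (hb : 0 ≤ b)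
    {s : Finset ℝ} (hs : ∀ y ∈ s, y ∈ Ioc 0 b ∧ truncSpline e A c X y = 0) :
    s.card ≤ knotCount X 0 b := by
  have h0 : (0 : ℝ) ∉ s := fun h => lt_irrefl _ (hs 0 h).1.1
  have hcard := Finset.card_insert_of_notMem h0
  cases e with
  | zero =>
    have := card_zeros_truncSpline_zero_le_of_nonneg hA (b := b) hnn (s := insert 0 s) fun y hy => by
      rcases Finset.mem_insert.1 hy with rfl | hy
      · exact ⟨⟨le_rfl, hb⟩, truncSpline_zero _ _ _ hX⟩
      · exact ⟨Ioc_subset_Icc_self (hs y hy).1, (hs y hy).2⟩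
    omega
  | succ e =>
    obtain ⟨t, ht, htc⟩ := exists_finset_zeros_truncSpline_Icc_zero e (A := (e + 3) * A)
      (by positivity) (fun i => (e + 2) * c i) hX hb
    have := two_mul_card_le_of_double_zeros (c := c) (s := insert 0 s) (fun y hy => by
      rcases Finset.mem_insert.1 hy with rfl | hy
      · exact ⟨⟨le_rfl, hb⟩, truncSpline_zero _ _ _ hX, truncSpline_zero _ _ _ hX⟩
      · exact ⟨Ioc_subset_Icc_self (hs y hy).1, (hs y hy).2,
          truncSpline_derivative_eq_zero hnn (hs y hy).1.1 (hs y hy).2⟩) ht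
    omega

/-- A nonnegative truncated spline of degree `e + 2` with `p` positive zeros in `[a, b]` has at
least `p - (e + 2)` knots in `(a, b)`. -/
theorem card_zeros_le_knotCount {e : ℕ} {A : ℝ} (hA : 0 < A) {c X : ι → ℝ}
    (hnn : ∀ y, 0 ≤ y → 0 ≤ truncSpline e A c X y) {a b : ℝ} (ha : 0 < a)
    {s : Finset ℝ} (hs : ∀ y ∈ s, y ∈ Icc a b ∧ truncSpline e A c X y = 0) :
    s.card ≤ knotCount X a b + (e + 2) := by
  cases e with
  | zero =>
    have := card_zeros_truncSpline_zero_le_of_nonneg hA (fun y hy => hnn y (ha.le.trans hy)) hs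
    omega
  | succ e =>
    obtain ⟨t, ht, htc⟩ := exists_finset_zeros_truncSpline e (A := (e + 3) * A)
      (by positivity) (fun i => (e + 2) * c i) X a b
    have := two_mul_card_le_of_double_zeros (c := c) (s := s) (fun y hy => ⟨(hs y hy).1, (hs y hy).2,
      truncSpline_derivative_eq_zero hnn (ha.trans_le (hs y hy).1.1) (hs y hy).2⟩) ht
    omega

end Spline

section FinitelySupported

variable {m : ℕ} {Y : Fin m → ℝ} {G : Measure ℝ}

theorem restrict_range_eq_self (hsupp : G {y | y ∉ range Y} = 0) : G.restrict (range Y) = G :=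
  Measure.restrict_eq_self_of_ae_mem hsupp

theorem integrable_of_range [IsFiniteMeasure G] (hsupp : G {y | y ∉ range Y} = 0) (f : ℝ → ℝ) :
    Integrable f G := by
  rw [← restrict_range_eq_self hsupp]
  exact IntegrableOn.of_finite (finite_range Y)

theorem integral_eq_sum_of_range [IsFiniteMeasure G] (hsupp : G {y | y ∉ range Y} = 0)
    (hY : Function.Injective Y) (f : ℝ → ℝ) :
    ∫ y, f y ∂G = ∑ j, G.real {Y j} * f (Y j) := by
  have hint := integrable_of_range hsupp f
  have hrange : (range Y : Set ℝ) = ((Finset.univ.map ⟨Y, hY⟩ : Finset ℝ) : Set ℝ) := by simp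
  have h1 : ∫ y, f y ∂G = ∫ y in range Y, f y ∂G := by rw [restrict_range_eq_self hsupp]
  rw [h1, hrange, setIntegral_finset _ hint.integrableOn, Finset.sum_map]
  rfl

end FinitelySupported

/-- If `∏ i, (1 + ε r_i)` is at most `1` for all `ε ∈ [0, 1]`, then its derivative at `0` is
nonpositive. -/
theorem sum_nonpos_of_prod_one_add_mul_le_one {ι : Type*} [Fintype ι] (r : ι → ℝ)
    (h : ∀ ε ∈ Icc (0 : ℝ) 1, ∏ i, (1 + ε * r i) ≤ 1) : ∑ i, r i ≤ 0 := by
  classical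
  have hd : HasDerivAt (fun ε : ℝ => ∏ i, (1 + ε * r i)) (∑ i, r i) 0 := by
    have := HasDerivAt.fun_finsetProd (u := Finset.univ) (f := fun i (ε : ℝ) => 1 + ε * r i)
      (f' := r) (x := 0) fun i _ => by
        simpa using ((hasDerivAt_id' (0 : ℝ)).mul_const (r i)).const_add 1
    simpa using this
  have hmax : IsLocalMaxOn (fun ε : ℝ => ∏ i, (1 + ε * r i)) (Icc 0 1) 0 := by
    filter_upwards [self_mem_nhdsWithin] with ε hε
    simpa using h ε hε
  have hcone : (1 : ℝ) ∈ posTangentConeAt (Icc (0 : ℝ) 1) 0 :=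
    mem_posTangentConeAt_of_segment_subset (by rw [zero_add, segment_eq_Icc zero_le_one])
  simpa using hmax.hasFDerivWithinAt_nonpos hd.hasFDerivAt.hasFDerivWithinAt hcone

section MLE

variable {k n : ℕ} {X : Fin n → ℝ} {G : Measure ℝ}

theorem mixDens_dirac (k : ℕ) (x y : ℝ) :
    mixDens k (Measure.dirac y) x = (k : ℝ) * max (y - x) 0 ^ (k - 1) / y ^ k := by
  simp [mixDens]

theorem mixDens_nonneg (hG : G (Iic 0) = 0) (x : ℝ) : 0 ≤ mixDens k G x := by
  refine integral_nonneg_of_ae ?_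
  have : ∀ᵐ y ∂G, y ∉ Iic (0 : ℝ) := measure_eq_zero_iff_ae_notMem.1 hG
  filter_upwards [this] with y hy
  have : 0 < y := not_le.1 hy
  simp only [Pi.zero_apply]
  positivity

theorem mixDens_add_dirac [IsFiniteMeasure G]
    (hint : ∀ f : ℝ → ℝ, Integrable f G) {ε : ℝ} (h0 : 0 ≤ ε) (h1 : ε ≤ 1) (x y : ℝ) :
    mixDens k (ENNReal.ofReal (1 - ε) • G + ENNReal.ofReal ε • Measure.dirac y) x =
      (1 - ε) * mixDens k G x + ε * mixDens k (Measure.dirac y) x := by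
  unfold mixDens
  rw [integral_add_measure ((hint _).smul_measure ENNReal.ofReal_ne_top)
    ((integrable_dirac (by simp)).smul_measure ENNReal.ofReal_ne_top),
    integral_smul_measure, integral_smul_measure, ENNReal.toReal_ofReal (sub_nonneg.2 h1), ENNReal.toReal_ofReal h0, smul_eq_mul, smul_eq_mul]

theorem IsMLE.mixDens_pos (hk : k ≠ 0) (hG : IsMLE k n X G) (hXpos : ∀ i, 0 < X i) (i : Fin n) :
    0 < mixDens k G (X i) := by
  obtain ⟨y, hy⟩ : ∃ y : ℝ, ∀ i, X i < y := by
    obtain ⟨y, hy⟩ := (finite_range X).bddAbove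
    exact ⟨y + 1, fun i => lt_of_le_of_lt (hy (mem_range_self i)) (lt_add_one y)⟩
  have hy0 : 0 < y := (hXpos i).trans (hy i)
  have hlik := hG.2.2 (Measure.dirac y) inferInstance (by simp [hy0])
  have hpos : 0 < lik k n X (Measure.dirac y) := by
    refine Finset.prod_pos fun i _ => ?_
    rw [mixDens_dirac, max_eq_left (sub_nonneg.2 (hy i).le)]
    have := sub_pos.2 (hy i)
    have : 0 < k := Nat.pos_of_ne_zero hk
    positivity
  refine lt_of_le_of_ne (mixDens_nonneg hG.2.1 _) fun h => ?_
  exact (hpos.trans_le hlik).ne' (Finset.prod_eq_zero (Finset.mem_univ i) h.symm)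

/-- The directional derivative of the log-likelihood at the MLE towards a point mass is
nonpositive. -/
theorem IsMLE.sum_div_le (hk : k ≠ 0) (hG : IsMLE k n X G) (hXpos : ∀ i, 0 < X i)
    (hint : ∀ f : ℝ → ℝ, Integrable f G) {y : ℝ} (hy : 0 < y) :
    ∑ i, mixDens k (Measure.dirac y) (X i) / mixDens k G (X i) ≤ n := by
  have := hG.1
  have hpos := hG.mixDens_pos hk hXpos
  have key := sum_nonpos_of_prod_one_add_mul_le_one
    (fun i => mixDens k (Measure.dirac y) (X i) / mixDens k G (X i) - 1) fun ε hε => by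
      have hle := hG.2.2 (ENNReal.ofReal (1 - ε) • G + ENNReal.ofReal ε • Measure.dirac y)
        ⟨by
          simp only [Measure.coe_add, Measure.coe_smul, Pi.add_apply, Pi.smul_apply,
            measure_univ, smul_eq_mul, mul_one]
          rw [← ENNReal.ofReal_add (sub_nonneg.2 hε.2) hε.1]
          simp⟩ (by simp [hG.2.1, hy])
      unfold lik at hle
      have hprod : 0 < ∏ i, mixDens k G (X i) := Finset.prod_pos fun i _ => hpos i
      rw [← div_le_one hprod, ← Finset.prod_div_distrib] at hle
      refine le_of_eq_of_le (Finset.prod_congr rfl fun i _ => ?_) hle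
      rw [mixDens_add_dirac hint hε.1 hε.2]
      have := (hpos i).ne'
      field_simp
      ring
  simpa using key

/-- Equality holds in the directional inequality at the support points of the MLE. -/
theorem IsMLE.sum_div_eq (hk : k ≠ 0) (hG : IsMLE k n X G) (hXpos : ∀ i, 0 < X i)
    {m : ℕ} {Y : Fin m → ℝ} (hY : Function.Injective Y) (hYpos : ∀ j, 0 < Y j)
    (hsupp : G {y | y ∉ range Y} = 0) (hatoms : ∀ j, G {Y j} ≠ 0) (j : Fin m) :
    ∑ i, mixDens k (Measure.dirac (Y j)) (X i) / mixDens k G (X i) = n := by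
  have := hG.1
  have hpos := hG.mixDens_pos hk hXpos
  set D : Fin m → ℝ := fun j =>
    ∑ i, mixDens k (Measure.dirac (Y j)) (X i) / mixDens k G (X i) with hD
  have hle : ∀ j, D j ≤ n := fun j =>
    hG.sum_div_le hk hXpos (integrable_of_range hsupp) (hYpos j)
  have hmass : ∑ j, G.real {Y j} = 1 := by
    simpa using (integral_eq_sum_of_range hsupp hY fun _ => (1 : ℝ)).symm
  have hmean : ∑ j, G.real {Y j} * D j = n := by
    calc ∑ j, G.real {Y j} * D j
        = ∑ i, (∑ j, G.real {Y j} * mixDens k (Measure.dirac (Y j)) (X i)) /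
            mixDens k G (X i) := by
          simp only [hD, Finset.mul_sum, Finset.sum_div, mul_div_assoc]
          exact Finset.sum_comm
      _ = ∑ i : Fin n, (1 : ℝ) := by
          refine Finset.sum_congr rfl fun i _ => ?_
          rw [div_eq_one_iff_eq (hpos i).ne']
          simp only [mixDens_dirac]
          exact (integral_eq_sum_of_range hsupp hY
            fun y => (k : ℝ) * max (y - X i) 0 ^ (k - 1) / y ^ k).symm
      _ = n := by simp
  have hzero : ∑ j, G.real {Y j} * (n - D j) = 0 := by
    simp only [mul_sub, Finset.sum_sub_distrib, hmean, ← Finset.sum_mul, hmass, one_mul, sub_self]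
  have hj := (Finset.sum_eq_zero_iff_of_nonneg fun j _ =>
    mul_nonneg measureReal_nonneg (sub_nonneg.2 (hle j))).1 hzero j (Finset.mem_univ j)
  have hw : G.real {Y j} ≠ 0 := (measureReal_ne_zero_iff (measure_ne_top G _)).2 (hatoms j)
  have := (mul_eq_zero.1 hj).resolve_left hw
  change D j = n
  linarith

theorem truncSpline_eq_mul_sub_sum (e : ℕ) {y : ℝ} (hy : 0 < y) (f : Fin n → ℝ) :
    truncSpline e n (fun i => ((e + 2 : ℕ) : ℝ) / f i) X y =
      y ^ (e + 2) * (n - ∑ i, mixDens (e + 2) (Measure.dirac y) (X i) / f i) := by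
  unfold truncSpline
  rw [mul_sub, mul_comm (n : ℝ), Finset.mul_sum]
  congr 1
  refine Finset.sum_congr rfl fun i _ => ?_
  rw [mixDens_dirac, Nat.add_sub_assoc (by norm_num)]
  field_simp

end MLE

section Counting

variable {n : ℕ} {X : Fin n → ℝ}

theorem StrictMono.lt_iff_val_lt_card (hX : StrictMono X) (i : Fin n) (y : ℝ) :
    X i < y ↔ i.val < (Finset.univ.filter fun i => X i < y).card := by
  constructor
  · intro h
    have := Finset.card_le_card (s := Finset.Iic i) (t := Finset.univ.filter fun i => X i < y)
      fun l hl => by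
        simpa using (hX.monotone (Finset.mem_Iic.1 hl)).trans_lt h
    rw [Fin.card_Iic] at this
    omega
  · intro h
    by_contra hi
    have := Finset.card_le_card (t := Finset.Iio i) (s := Finset.univ.filter fun i => X i < y)
      fun l hl => by
        simp only [Finset.mem_filter, Finset.mem_univ, true_and] at hl
        exact Finset.mem_Iio.2 (hX.lt_iff_lt.1 (hl.trans_le (not_lt.1 hi)))
    rw [Fin.card_Iio] at this
    omega

theorem StrictMono.lt_of_card_add_knotCount_le (hX : StrictMono X) {a b : ℝ} (hab : a < b)
    {i : Fin n} (h : (Finset.univ.filter fun i => X i < b).card ≤ i.val + knotCount X a b) : a < X i := by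
  by_contra hi
  rw [not_lt] at hi
  have hdisj : Disjoint (Finset.Iic i) (Finset.univ.filter fun i => a < X i ∧ X i < b) := by
    refine Finset.disjoint_left.2 fun l hl hl' => ?_
    have := hX.monotone (Finset.mem_Iic.1 hl)
    have := (Finset.mem_filter.1 hl').2.1
    linarith
  have hsub : Finset.Iic i ∪ (Finset.univ.filter fun i => a < X i ∧ X i < b) ⊆
      Finset.univ.filter fun i => X i < b := by
    intro l hl
    refine Finset.mem_filter.2 ⟨Finset.mem_univ l, ?_⟩
    rcases Finset.mem_union.1 hl with hl | hl
    · exact ((hX.monotone (Finset.mem_Iic.1 hl)).trans hi).trans_lt hab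
    · exact (Finset.mem_filter.1 hl).2.2
  have := Finset.card_le_card hsub
  rw [Finset.card_union_of_disjoint hdisj, Fin.card_Iic] at this
  unfold knotCount at h
  omega

/-- Sufficiently many knots below each `Y j` and between any `Y j` and `Y l` produce an
interlacing subsequence of the knots. -/
theorem exists_interlacing_of_knotCount (hX : StrictMono X) {k m : ℕ} {Y : Fin m → ℝ}
    (hY : StrictMono Y) (hk : 0 < k)
    (hbelow : ∀ j : Fin m, j.val + 1 ≤ (Finset.univ.filter fun i => X i < Y j).card)
    (hbetween : ∀ j l : Fin m, j ≤ l → l.val + 1 ≤ j.val + knotCount X (Y j) (Y l) + k) :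
    ∃ idx : Fin m → Fin n, StrictMono idx ∧
      ∀ j : Fin m, X (idx j) < Y j ∧
        ∀ h : j.val + k < m, Y j < X (idx ⟨j.val + k, h⟩) := by
  set N : Fin m → ℕ := fun j => (Finset.univ.filter fun i => X i < Y j).card with hN
  have hNn : ∀ j, N j ≤ n := fun j => (Finset.card_le_univ _).trans (Fintype.card_fin n).le
  have hne : ∀ j : Fin m, (Finset.Ici j).Nonempty := fun j => ⟨j, Finset.mem_Ici.2 le_rfl⟩
  set I : Fin m → ℕ := fun j =>
    (Finset.Ici j).inf' (hne j) fun l => N l + j.val - l.val - 1 with hI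
  have hIle : ∀ j l, j ≤ l → I j ≤ N l + j.val - l.val - 1 := fun j l h =>
    Finset.inf'_le (fun l : Fin m => N l + j.val - l.val - 1) (Finset.mem_Ici.2 h)
  have hIeq : ∀ j, ∃ l, j ≤ l ∧ I j = N l + j.val - l.val - 1 := fun j => by
    obtain ⟨l, hl, h⟩ := Finset.exists_mem_eq_inf' (hne j) fun l => N l + j.val - l.val - 1
    exact ⟨l, Finset.mem_Ici.1 hl, h⟩
  have hIlt : ∀ j, I j < N j := fun j => by
    have h1 := hIle j j le_rfl
    have h2 := hbelow j
    change _ ≤ N j at h2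
    omega
  refine ⟨fun j => ⟨I j, (hIlt j).trans_le (hNn j)⟩, fun j j' hjj => ?_, fun j => ⟨?_, fun h => ?_⟩⟩
  · obtain ⟨l, hl, h⟩ := hIeq j'
    have h1 := hIle j l (hjj.le.trans hl)
    have h2 := hbelow l
    change _ ≤ N l at h2
    have h3 : j.val < j'.val := hjj
    change I j < I j'
    omega
  · exact (hX.lt_iff_val_lt_card _ _).2 (hIlt j)
  · obtain ⟨l, hl, hIl⟩ := hIeq ⟨j.val + k, h⟩
    have hl' : j.val + k ≤ l.val := hl
    have hjl : j < l := Fin.lt_def.2 (by omega)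
    refine hX.lt_of_card_add_knotCount_le (hY hjl) ?_
    have h1 := hbetween j l hjl.le
    have h2 := hbelow l
    change N l ≤ I ⟨j.val + k, h⟩ + _
    change _ ≤ N l at h2
    simp only at hIl
    omega

end Counting

/-- If the MLE `Ĝ` is a discrete measure whose support consists of the points
`Y₁ < … < Y_m` with `m < n`, then there is a subsequence of indices
`i₁ < … < i_m` such that `X_{i_j} < Y_j < X_{i_{j+k}}` for every `j`, where
`X_{i_l} = +∞` for `l > m` (so the upper bound is only asserted when `j + k ≤ m`,
i.e. `j.val + k < m` in 0-indexed form). -/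
theorem mle_support_interlacing (k n : ℕ) (hk : 2 ≤ k) (hn : 1 ≤ n)
    (X : Fin n → ℝ) (hX : StrictMono X) (hXpos : ∀ i, 0 < X i)
    (G : Measure ℝ) (hG : IsMLE k n X G)
    (m : ℕ) (hm : m < n) (Y : Fin m → ℝ) (hY : StrictMono Y)
    (hsupp : G {y | y ∉ range Y} = 0) (hatoms : ∀ j, G {Y j} ≠ 0) :
    ∃ idx : Fin m → Fin n, StrictMono idx ∧
      ∀ j : Fin m, X (idx j) < Y j ∧
        ∀ h : j.val + k < m, Y j < X (idx ⟨j.val + k, h⟩) := by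
  obtain ⟨e, rfl⟩ : ∃ e, k = e + 2 := ⟨k - 2, by omega⟩
  have hprob := hG.1
  have hYpos : ∀ j, 0 < Y j := fun j => by
    by_contra h
    exact hatoms j (measure_mono_null (singleton_subset_iff.2 (mem_Iic.2 (not_lt.1 h))) hG.2.1)
  set c : Fin n → ℝ := fun i => ((e + 2 : ℕ) : ℝ) / mixDens (e + 2) G (X i) with hc
  have hnn : ∀ y, 0 ≤ y → 0 ≤ truncSpline e n c X y := by
    intro y hy
    rcases hy.eq_or_lt with rfl | hy
    · exact (truncSpline_zero e _ _ hXpos).ge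
    · rw [hc, truncSpline_eq_mul_sub_sum e hy]
      exact mul_nonneg (by positivity) (sub_nonneg.2
        (hG.sum_div_le (by omega) hXpos (integrable_of_range hsupp) hy))
  have hzero : ∀ j, truncSpline e n c X (Y j) = 0 := fun j => by
    rw [hc, truncSpline_eq_mul_sub_sum e (hYpos j),
      hG.sum_div_eq (by omega) hXpos hY.injective hYpos hsupp hatoms j, sub_self, mul_zero]
  have hn0 : (0 : ℝ) < n := by exact_mod_cast hn
  refine exists_interlacing_of_knotCount hX hY (by omega) (fun j => ?_) fun j l hjl => ?_
  · have h := card_zeros_le_knotCount_zero hn0 hXpos hnn (hYpos j).le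
      (s := (Finset.Iic j).map ⟨Y, hY.injective⟩) fun y hy => by
        obtain ⟨l, hl, rfl⟩ := Finset.mem_map.1 hy
        exact ⟨⟨hYpos l, hY.monotone (Finset.mem_Iic.1 hl)⟩, hzero l⟩
    rw [Finset.card_map, Fin.card_Iic] at h
    simpa [knotCount, hXpos] using h
  · have h := card_zeros_le_knotCount hn0 hnn (hYpos j) (b := Y l)
      (s := (Finset.Icc j l).map ⟨Y, hY.injective⟩) fun y hy => by
        obtain ⟨i, hi, rfl⟩ := Finset.mem_map.1 hy
        obtain ⟨h1, h2⟩ := Finset.mem_Icc.1 hi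
        exact ⟨⟨hY.monotone h1, hY.monotone h2⟩, hzero i⟩
    rw [Finset.card_map, Fin.card_Icc] at h
    omega
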